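/- For any coded prae-dilator T, the map ϑ : D^T_{ϑ(T)} → ϑ(T) defined by ϑ(⟨a,σ⟩) := ϑ_σ^{s₀,…,s_{n−1}}, where a = {s₀,…,s_{n−1}} with s₀ <_{ϑ(T)} … <_{ϑ(T)} s_{n−1}, is a Bachmann-Howard collapse; hence the linear order ϑ(T) is a Bachmann-Howard fixed point of T. -/

import Mathlib

structure PraeDilator where
  A : ℕ → Type
  inst : ∀ n, LinearOrder (A n)
  map : ∀ {n m : ℕ}, (Fin n ↪o Fin m) → A n → A m
  map_strictMono : ∀ {n m : ℕ} (f : Fin n ↪o Fin m) (σ τ : A n),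
      (inst n).lt σ τ → (inst m).lt (map f σ) (map f τ)
  map_id : ∀ (n : ℕ) (σ : A n), map (OrderIso.refl (Fin n)).toOrderEmbedding σ = σ
  map_comp : ∀ {n m k : ℕ} (f : Fin n ↪o Fin m) (g : Fin m ↪o Fin k) (σ : A n),
      map (f.trans g) σ = map g (map f σ)
  supp : ∀ n, A n → Finset (Fin n)
  supp_natural : ∀ {n m : ℕ} (f : Fin n ↪o Fin m) (σ : A n),
      supp m (map f σ) = (supp n σ).map f.toEmbedding
  supp_spec : ∀ (n : ℕ) (σ : A n),
      ∃ τ : A (supp n σ).card, map ((supp n σ).orderEmbOfFin rfl) τ = σ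

attribute [instance] PraeDilator.inst



/-- The strictly increasing map `Fin a.card ↪o Fin d.card` induced by an inclusion `a ⊆ d`. -/
def inclEmb {X : Type} [LinearOrder X] {a d : Finset X} (h : a ⊆ d) :
    Fin a.card ↪o Fin d.card :=
  OrderEmbedding.ofStrictMono
    (fun i => (d.orderIsoOfFin rfl).symm ⟨a.orderEmbOfFin rfl i, h (a.orderEmbOfFin_mem rfl i)⟩)
    (fun i j hij => by
      apply (d.orderIsoOfFin rfl).symm.strictMono
      exact Subtype.mk_lt_mk.mpr ((a.orderEmbOfFin rfl).strictMono hij))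

structure DApp (D : PraeDilator) (X : Type) [LinearOrder X] where
  a : Finset X
  σ : D.A a.card
  hsupp : D.supp a.card σ = Finset.univ

def DLt (D : PraeDilator) (X : Type) [LinearOrder X] (x y : DApp D X) : Prop :=
  D.map (inclEmb (Finset.subset_union_left : x.a ⊆ x.a ∪ y.a)) x.σ <
    D.map (inclEmb (Finset.subset_union_right : y.a ⊆ x.a ∪ y.a)) y.σ

/-- Terms of the notation system `ϑ(T)`: a term `ϑ_σ^{s₀,…,s_{n−1}}` consists of a finite
sequence of previously constructed terms together with an element `σ ∈ T_n`. -/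
inductive ThT (D : PraeDilator) : Type where
  | node (n : ℕ) (ss : Fin n → ThT D) (σ : D.A n) : ThT D

/-- Size of a term of `ϑ(T)`. -/
def tsizeT (D : PraeDilator) : ThT D → ℕ
  | .node _ ss _ => (Finset.univ.sum fun i => tsizeT D (ss i)) + 1

theorem tsizeT_lt (D : PraeDilator) (n : ℕ) (ss : Fin n → ThT D) (σ : D.A n) (i : Fin n) :
    tsizeT D (ss i) < tsizeT D (.node n ss σ) := by
  have : tsizeT D (ss i) ≤ Finset.univ.sum fun j => tsizeT D (ss j) :=
    Finset.single_le_sum (f := fun j => tsizeT D (ss j)) (fun _ _ => Nat.zero_le _) (Finset.mem_univ i)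
  calc tsizeT D (ss i) ≤ _ := this
    _ < _ + 1 := Nat.lt_succ_self _
    _ = tsizeT D (.node n ss σ) := by rw [tsizeT]

/-- The relation `<_{ϑ(T)}` on terms of `ϑ(T)`, following the simultaneous recursive
definition: `ϑ_σ^{s₀,…,s_{n−1}} < ϑ_τ^{t₀,…,t_{m−1}}` iff either (i') `T_f(σ) <_{T_k} T_g(τ)`
for the strictly increasing `f : n → k` and `g : m → k` onto `k = |{s₀,…,t_{m−1}}|` with
`f i < g j ↔ s_i < t_j` and `g j < f i ↔ t_j < s_i`, together with `n = 0` or `s_{n−1} < t`;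
or (ii') `m > 0` and `s ≤ t_{m−1}`. -/
def tlt (D : PraeDilator) : ThT D → ThT D → Prop
  | .node n ss σ, .node m ts τ =>
    ((∃ (k : ℕ) (f : Fin n ↪o Fin k) (g : Fin m ↪o Fin k),
      (∀ (i : Fin n) (j : Fin m), f i < g j ↔ tlt D (ss i) (ts j)) ∧
      (∀ (i : Fin n) (j : Fin m), g j < f i ↔ tlt D (ts j) (ss i)) ∧
      (∀ p : Fin k, (∃ i, f i = p) ∨ (∃ j, g j = p)) ∧
      D.map f σ < D.map g τ) ∧
      (∀ h : 0 < n, tlt D (ss ⟨n - 1, Nat.sub_lt h Nat.one_pos⟩) (.node m ts τ))) ∨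
    (∃ h : 0 < m,
      tlt D (.node n ss σ) (ts ⟨m - 1, Nat.sub_lt h Nat.one_pos⟩) ∨
      ThT.node n ss σ = ts ⟨m - 1, Nat.sub_lt h Nat.one_pos⟩)
termination_by s t => tsizeT D s + tsizeT D t
decreasing_by
  · have h1 := tsizeT_lt D n ss σ i
    have h2 := tsizeT_lt D m ts τ j
    omega
  · have h1 := tsizeT_lt D m ts τ j
    have h2 := tsizeT_lt D n ss σ i
    omega
  · have h1 := tsizeT_lt D n ss σ ⟨n - 1, Nat.sub_lt h Nat.one_pos⟩
    omega
  · have h1 := tsizeT_lt D m ts τ ⟨m - 1, Nat.sub_lt h Nat.one_pos⟩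
    omega

/-- Well-formed terms of `ϑ(T)`: in `ϑ_σ^{s₀,…,s_{n−1}}` the listed terms must be
well-formed and strictly increasing, and `σ ∈ T_n` must have full support
`supp^T_n(σ) = {0,…,n−1}`. -/
inductive ThTWF (D : PraeDilator) : ThT D → Prop where
  | node (n : ℕ) (ss : Fin n → ThT D) (σ : D.A n) :
      (∀ i, ThTWF D (ss i)) → (∀ i j : Fin n, i < j → tlt D (ss i) (ss j)) →
      D.supp n σ = Finset.univ → ThTWF D (.node n ss σ)

/-- `θ : A → X` is a Bachmann-Howard collapse with respect to the relations `ltA`, `ltX` and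
the support function `supp`. -/
def IsBHCollapse {A X : Type} (ltA : A → A → Prop) (ltX : X → X → Prop)
    (supp : A → Finset X) (θ : A → X) : Prop :=
  (∀ σ τ : A, ltA σ τ → (∀ x ∈ supp σ, ltX x (θ τ)) → ltX (θ σ) (θ τ)) ∧
  (∀ σ : A, ∀ x ∈ supp σ, ltX x (θ σ))

/-- The collapsing map `ϑ : D^T_{ϑ(T)} → ϑ(T)`, sending `⟨a,σ⟩` with
`a = {s₀ <_{ϑ(T)} … <_{ϑ(T)} s_{n−1}}` to the term `ϑ_σ^{s₀,…,s_{n−1}}`.  Here `L` is a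
linear-order structure on the well-formed terms of `ϑ(T)` whose strict part is `<_{ϑ(T)}`
(such a structure exists since `<_{ϑ(T)}` linearly orders `ϑ(T)`). -/
def collapseTh (D : PraeDilator) (L : LinearOrder {t : ThT D // ThTWF D t})
    (hL : ∀ s t : {t : ThT D // ThTWF D t}, L.lt s t ↔ tlt D s.val t.val)
    (x : @DApp D {t : ThT D // ThTWF D t} L) : {t : ThT D // ThTWF D t} :=
  letI := L
  ⟨ThT.node x.a.card (fun i => (x.a.orderEmbOfFin rfl i).val) x.σ,
    ThTWF.node _ _ _ (fun i => (x.a.orderEmbOfFin rfl i).property)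
      (fun i j hij => (hL _ _).mp ((x.a.orderEmbOfFin rfl).strictMono hij))
      x.hsupp⟩

theorem orderEmbOfFin_inclEmb {X : Type} [LinearOrder X] {a d : Finset X} (h : a ⊆ d)
    (i : Fin a.card) : d.orderEmbOfFin rfl (inclEmb h i) = a.orderEmbOfFin rfl i := by
  change ((d.orderIsoOfFin rfl) ((d.orderIsoOfFin rfl).symm _) : X) = _
  rw [OrderIso.apply_symm_apply]

theorem inclEmb_lt_inclEmb_iff {X : Type} [LinearOrder X] {a b d : Finset X}
    (ha : a ⊆ d) (hb : b ⊆ d) (i : Fin a.card) (j : Fin b.card) :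
    inclEmb ha i < inclEmb hb j ↔ a.orderEmbOfFin rfl i < b.orderEmbOfFin rfl j := by
  rw [← orderEmbOfFin_inclEmb ha, ← orderEmbOfFin_inclEmb hb, OrderEmbedding.lt_iff_lt]

theorem exists_inclEmb_eq {X : Type} [LinearOrder X] {a d : Finset X} (h : a ⊆ d)
    (p : Fin d.card) (hp : d.orderEmbOfFin rfl p ∈ a) : ∃ i, inclEmb h i = p := by
  refine ⟨(a.orderIsoOfFin rfl).symm ⟨_, hp⟩, (d.orderEmbOfFin rfl).injective ?_⟩
  rw [orderEmbOfFin_inclEmb, ← Finset.coe_orderIsoOfFin_apply, OrderIso.apply_symm_apply]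

theorem tlt_node_last (D : PraeDilator) {n : ℕ} (ss : Fin n → ThT D) (σ : D.A n) (h : 0 < n) :
    tlt D (ss ⟨n - 1, Nat.sub_lt h Nat.one_pos⟩) (.node n ss σ) := by
  generalize hs : ss ⟨n - 1, Nat.sub_lt h Nat.one_pos⟩ = s
  cases s with
  | node m ts τ =>
    rw [tlt]
    exact Or.inr ⟨h, Or.inr hs.symm⟩

/-- For any coded prae-dilator `T`, the map `ϑ : D^T_{ϑ(T)} → ϑ(T)` defined by
`ϑ(⟨a,σ⟩) := ϑ_σ^{s₀,…,s_{n−1}}` (where `a = {s₀ <_{ϑ(T)} … <_{ϑ(T)} s_{n−1}}`) is a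
Bachmann-Howard collapse; hence the linear order `ϑ(T)` is a Bachmann-Howard fixed point
of `T`. -/
theorem collapseTh_isBHCollapse (D : PraeDilator)
    (L : LinearOrder {t : ThT D // ThTWF D t})
    (hL : ∀ s t : {t : ThT D // ThTWF D t}, L.lt s t ↔ tlt D s.val t.val) :
    @IsBHCollapse (@DApp D {t : ThT D // ThTWF D t} L) {t : ThT D // ThTWF D t}
      (@DLt D {t : ThT D // ThTWF D t} L)
      (fun s t => tlt D s.val t.val)
      (fun x => x.a)
      (collapseTh D L hL) := by
  let := L
  refine ⟨fun x y hxy hsupp => ?_, fun x s hs => ?_⟩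
  · change tlt D (.node _ _ _) (.node _ _ _)
    rw [tlt]
    refine Or.inl ⟨⟨_, _, _, fun i j => ?_, fun i j => ?_, fun p => ?_, hxy⟩,
      fun h => hsupp _ (x.a.orderEmbOfFin_mem rfl _)⟩
    · exact (inclEmb_lt_inclEmb_iff _ _ i j).trans (hL _ _)
    · exact (inclEmb_lt_inclEmb_iff _ _ j i).trans (hL _ _)
    · exact (Finset.mem_union.mp ((x.a ∪ y.a).orderEmbOfFin_mem rfl p)).imp
        (exists_inclEmb_eq _ p) (exists_inclEmb_eq _ p)
  · have h : 0 < x.a.card := Finset.card_pos.mpr ⟨s, hs⟩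
    have hlast : x.a.orderEmbOfFin rfl ⟨x.a.card - 1, Nat.sub_lt h Nat.one_pos⟩ <
        collapseTh D L hL x :=
      (hL _ _).mpr (tlt_node_last D (fun i => (x.a.orderEmbOfFin rfl i).val) x.σ h)
    refine (hL _ _).mp (lt_of_le_of_lt ?_ hlast)
    rw [Finset.orderEmbOfFin_last rfl h]
    exact x.a.le_max' s hs
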